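/- arXiv:1606.06691 — 4 statements merged into one kernel-verified Lean document; each statement's English description precedes it below -/
import Mathlib

section
/- Let n ≥ 2 be an integer, β ≥ 1, 0 ≤ α < n−1, and N ≥ n+β. Then there exists a constant C (depending only on n, α, β, N) such that for every x ∈ ℝⁿ and every R ≥ 0, ∫_{ℝⁿ} ⟨z⟩^{-N} / ( |x−z|^α ⟨|x−z|+R⟩ ⟨|x−z|−R⟩^β ) dz ≤ C / ( ⟨x⟩^α ⟨|x|+R⟩ ⟨R−|x|⟩^β ). -/
open MeasureTheory Real
open scoped ENNReal

/-- The Japanese bracket `⟨x⟩ = (1+|x|²)^{1/2}` on Euclidean space. -/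
noncomputable def jb {n : ℕ} (x : EuclideanSpace ℝ (Fin n)) : ℝ := Real.sqrt (1 + ‖x‖ ^ 2)

/-- The Japanese bracket `⟨t⟩ = (1+t²)^{1/2}` on the real line. -/
noncomputable def jbr (t : ℝ) : ℝ := Real.sqrt (1 + t ^ 2)

theorem jbr_pos (t : ℝ) : 0 < jbr t := Real.sqrt_pos.2 (by positivity)

theorem one_le_jbr (t : ℝ) : 1 ≤ jbr t := by
  unfold jbr; rw [Real.one_le_sqrt]; nlinarith [sq_nonneg t]

theorem abs_le_jbr (t : ℝ) : |t| ≤ jbr t := by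
  unfold jbr; apply Real.abs_le_sqrt; linarith

theorem jbr_sq (t : ℝ) : jbr t ^ 2 = 1 + t ^ 2 := Real.sq_sqrt (by positivity)

theorem jbr_le_of_abs_le {a b c : ℝ} (hc : 0 ≤ c) (h : |a| ≤ |b| + c) : jbr a ≤ jbr b + c := by
  have h1 := jbr_sq a
  have h2 := jbr_sq b
  have h3 := abs_le_jbr b
  have h4 := jbr_pos a
  have h5 := jbr_pos b
  have h6 : a ^ 2 ≤ (|b| + c) ^ 2 := by
    rw [← sq_abs a]; exact pow_le_pow_left₀ (abs_nonneg _) h 2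
  have h7 := sq_abs b
  refine (sq_le_sq₀ h4.le (by positivity)).1 ?_
  nlinarith

theorem jbr_two_mul_le {a b : ℝ} (h : |a| ≤ 2 * |b|) : jbr a ≤ 2 * jbr b := by
  have h1 := jbr_sq a
  have h2 := jbr_sq b
  have h4 := jbr_pos a
  have h5 := jbr_pos b
  have h6 : a ^ 2 ≤ (2 * |b|) ^ 2 := by
    rw [← sq_abs a]; exact pow_le_pow_left₀ (abs_nonneg _) h 2
  have h7 := sq_abs b
  refine (sq_le_sq₀ h4.le (by positivity)).1 ?_
  nlinarith

theorem jb_eq {n : ℕ} (x : EuclideanSpace ℝ (Fin n)) : jb x = jbr ‖x‖ := rfl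

theorem aux_W (n : ℕ) (β : ℝ) (hβ : 0 < β) (l : ℝ) (hl : 0 < l) :
    Integrable (fun z : EuclideanSpace ℝ (Fin n) => (l + ‖z‖) ^ (-(n + β))) ∧
    ∫ z : EuclideanSpace ℝ (Fin n), (l + ‖z‖) ^ (-(n + β)) =
      l ^ (-β) * ∫ z : EuclideanSpace ℝ (Fin n), (1 + ‖z‖) ^ (-(n + β)) := by
  have h1 : Integrable (fun z : EuclideanSpace ℝ (Fin n) => (1 + ‖z‖) ^ (-(n + β))) := by
    apply integrable_one_add_norm
    simp [hβ]
  have e : (fun z : EuclideanSpace ℝ (Fin n) => (l + ‖z‖) ^ (-(n + β))) =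
      fun z => l ^ (-(n + β)) * (fun z : EuclideanSpace ℝ (Fin n) => (1 + ‖z‖) ^ (-(n + β))) (l⁻¹ • z) := by
    funext z
    simp only [norm_smul, norm_inv, Real.norm_eq_abs, abs_of_pos hl]
    rw [← Real.mul_rpow hl.le (by positivity)]
    congr 1
    field_simp
  rw [e]
  constructor
  · exact ((h1.comp_smul (inv_ne_zero hl.ne')).const_mul _)
  · rw [integral_const_mul, Measure.integral_comp_inv_smul_of_nonneg volume
      (fun z : EuclideanSpace ℝ (Fin n) => (1 + ‖z‖) ^ (-(n + β))) hl.le, smul_eq_mul,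
      ← mul_assoc]
    congr 1
    rw [finrank_euclideanSpace_fin, ← Real.rpow_natCast, ← Real.rpow_add hl]
    congr 1; ring

theorem aux_B (n : ℕ) (hn : 1 ≤ n) (γ : ℝ) (hγ : γ < n) (s : ℝ) (hs : 0 < s)
    (x : EuclideanSpace ℝ (Fin n)) :
    Integrable (fun z : EuclideanSpace ℝ (Fin n) =>
      (Metric.ball (0 : EuclideanSpace ℝ (Fin n)) s).indicator (fun w => ‖w‖ ^ (-γ)) (x - z)) ∧
    ∫ z : EuclideanSpace ℝ (Fin n),
      (Metric.ball (0 : EuclideanSpace ℝ (Fin n)) s).indicator (fun w => ‖w‖ ^ (-γ)) (x - z) =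
      s ^ (n - γ) * ∫ z : EuclideanSpace ℝ (Fin n),
      (Metric.ball (0 : EuclideanSpace ℝ (Fin n)) 1).indicator (fun w => ‖w‖ ^ (-γ)) z := by
  have h1 : Integrable ((Metric.ball (0 : EuclideanSpace ℝ (Fin n)) 1).indicator
      (fun w => ‖w‖ ^ (-γ))) := by
    rw [integrable_indicator_iff Metric.isOpen_ball.measurableSet]
    refine integrableOn_ball_of_norm_le_rpow (C := 1) (α := γ) ?_ ?_ ?_ ?_
    · simpa using hn
    · simpa using hγ
    · refine Filter.Eventually.of_forall fun w => ?_
      rw [one_mul, Real.norm_eq_abs, abs_of_nonneg (by positivity)]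
    · exact Measurable.aestronglyMeasurable (by fun_prop)
  have e : (Metric.ball (0 : EuclideanSpace ℝ (Fin n)) s).indicator (fun w => ‖w‖ ^ (-γ)) =
      fun z => s ^ (-γ) * ((Metric.ball (0 : EuclideanSpace ℝ (Fin n)) 1).indicator
        (fun w => ‖w‖ ^ (-γ))) (s⁻¹ • z) := by
    funext z
    have hn1 : ‖s⁻¹ • z‖ = s⁻¹ * ‖z‖ := by
      rw [norm_smul, norm_inv, Real.norm_eq_abs, abs_of_pos hs]
    by_cases hz : ‖z‖ < s
    · rw [Set.indicator_of_mem (by simpa using hz), Set.indicator_of_mem]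
      · rw [hn1, ← Real.mul_rpow hs.le (by positivity)]
        congr 1; field_simp
      · rw [mem_ball_zero_iff, hn1, inv_mul_lt_iff₀ hs]; simpa using hz
    · rw [Set.indicator_of_notMem (by simpa using hz), Set.indicator_of_notMem, mul_zero]
      rw [mem_ball_zero_iff, hn1, inv_mul_lt_iff₀ hs]; simpa using hz
  have h2 : Integrable ((Metric.ball (0 : EuclideanSpace ℝ (Fin n)) s).indicator
      (fun w => ‖w‖ ^ (-γ))) := by
    rw [e]
    exact ((h1.comp_smul (inv_ne_zero hs.ne')).const_mul _)
  refine ⟨h2.comp_sub_left x, ?_⟩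
  rw [integral_sub_left_eq_self, e, integral_const_mul,
    Measure.integral_comp_inv_smul_of_nonneg _ _ hs.le, smul_eq_mul, ← mul_assoc]
  congr 1
  rw [finrank_euclideanSpace_fin, ← Real.rpow_natCast, ← Real.rpow_add hs]
  congr 1; ring

theorem aux_key (n : ℕ) (hn : 1 ≤ n) (β : ℝ) (hβ : 0 < β) (γ : ℝ) (hγ0 : 0 ≤ γ) (hγ : γ < n) :
    ∃ C : ℝ, 0 < C ∧ ∀ (l : ℝ), 1 / 2 ≤ l → ∀ x : EuclideanSpace ℝ (Fin n),
      ∃ G : EuclideanSpace ℝ (Fin n) → ℝ, Integrable G ∧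
        (∀ z, (l + ‖z‖) ^ (-(n + β)) * ‖x - z‖ ^ (-γ) ≤ G z) ∧
        ∫ z, G z ≤ C * (l ^ (-β) * jb x ^ (-γ)) := by
  set A := ∫ z : EuclideanSpace ℝ (Fin n), (1 + ‖z‖) ^ (-(n + β)) with hA
  set B := ∫ z : EuclideanSpace ℝ (Fin n),
      (Metric.ball (0 : EuclideanSpace ℝ (Fin n)) 1).indicator (fun w => ‖w‖ ^ (-γ)) z with hB
  have hA0 : 0 ≤ A := integral_nonneg fun z => by positivity
  have hB0 : 0 ≤ B := integral_nonneg fun z => Set.indicator_nonneg (fun _ _ => by positivity) _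
  refine ⟨(1 / 2) ^ (-γ) * A + (1 / 4) ^ (-(n : ℝ)) * (1 / 2) ^ ((n : ℝ) - γ) * B + 1,
    by positivity, ?_⟩
  intro l hl x
  have hl0 : 0 < l := by linarith
  have hx : 0 < jb x := jbr_pos _
  obtain ⟨i1, e1⟩ := aux_W n β hβ l hl0
  obtain ⟨i2, e2⟩ := aux_B n hn γ hγ (jb x / 2) (by positivity) x
  refine ⟨fun z => (jb x / 2) ^ (-γ) * (l + ‖z‖) ^ (-(n + β)) +
    l ^ (-β) * (jb x / 4) ^ (-(n : ℝ)) *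
    (Metric.ball (0 : EuclideanSpace ℝ (Fin n)) (jb x / 2)).indicator (fun w => ‖w‖ ^ (-γ)) (x - z),
    (i1.const_mul _).add (i2.const_mul _), ?_, ?_⟩
  · intro z
    beta_reduce
    by_cases h : ‖x - z‖ < jb x / 2
    · rw [Set.indicator_of_mem (by simpa using h)]
      have h0 : 0 ≤ (jb x / 2) ^ (-γ) * (l + ‖z‖) ^ (-(n + β)) := by positivity
      have h1 : jb x ≤ jb z + ‖x - z‖ := by
        rw [jb_eq, jb_eq]
        apply jbr_le_of_abs_le (norm_nonneg _)
        rw [abs_norm, abs_norm]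
        have := norm_add_le z (x - z)
        simpa using this
      have h2 : jb z ≤ 1 + ‖z‖ := by
        have := @jbr_le_of_abs_le ‖z‖ 0 ‖z‖ (norm_nonneg _) (by simp)
        rw [jb_eq]
        simpa [jbr] using this
      have h3 : jb x / 4 ≤ l + ‖z‖ := by
        have := norm_nonneg z
        linarith
      have h4 : (l + ‖z‖) ^ (-(n + β)) ≤ l ^ (-β) * (jb x / 4) ^ (-(n : ℝ)) := by
        rw [show -((n : ℝ) + β) = -β + -n by ring, Real.rpow_add (by positivity)]
        apply mul_le_mul _ _ (by positivity) (by positivity)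
        · exact Real.rpow_le_rpow_of_nonpos hl0 (by linarith [norm_nonneg z]) (by linarith)
        · exact Real.rpow_le_rpow_of_nonpos (by positivity) h3 (by simp)
      have := mul_le_mul_of_nonneg_right h4 (show 0 ≤ ‖x - z‖ ^ (-γ) by positivity)
      linarith
    · rw [Set.indicator_of_notMem (by simpa using h), mul_zero, add_zero, mul_comm]
      apply mul_le_mul_of_nonneg_right _ (by positivity)
      exact Real.rpow_le_rpow_of_nonpos (by positivity) (not_lt.1 h) (by linarith)
  · rw [integral_add (i1.const_mul _) (i2.const_mul _), integral_const_mul, integral_const_mul,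
      e1, e2, ← hA, ← hB]
    have q1 : (jb x / 2) ^ (-γ) = (1 / 2) ^ (-γ) * jb x ^ (-γ) := by
      rw [← Real.mul_rpow (by norm_num) hx.le]; congr 1; ring
    have q2 : (jb x / 4) ^ (-(n : ℝ)) = (1 / 4) ^ (-(n : ℝ)) * jb x ^ (-(n : ℝ)) := by
      rw [← Real.mul_rpow (by norm_num) hx.le]; congr 1; ring
    have q3 : (jb x / 2) ^ ((n : ℝ) - γ) = (1 / 2) ^ ((n : ℝ) - γ) * jb x ^ ((n : ℝ) - γ) := by
      rw [← Real.mul_rpow (by norm_num) hx.le]; congr 1; ring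
    have q4 : jb x ^ (-γ) = jb x ^ (-(n : ℝ)) * jb x ^ ((n : ℝ) - γ) := by
      rw [← Real.rpow_add hx]; congr 1; ring
    rw [q1, q2, q3]
    have hp : 0 ≤ l ^ (-β) * jb x ^ (-γ) := by positivity
    calc _ = ((1 / 2) ^ (-γ) * A) * (l ^ (-β) * jb x ^ (-γ)) +
        ((1 / 4) ^ (-(n : ℝ)) * (1 / 2) ^ ((n : ℝ) - γ) * B) *
          (l ^ (-β) * (jb x ^ (-(n : ℝ)) * jb x ^ ((n : ℝ) - γ))) := by ring
      _ ≤ _ := by rw [← q4]; nlinarith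

theorem aux_H (n : ℕ) (hn : 1 ≤ n) (β : ℝ) (hβ : 0 < β) (γ : ℝ) (hγ0 : 0 ≤ γ) (hγ : γ < n)
    (N : ℝ) (hN : (n : ℝ) + β ≤ N) :
    ∃ C : ℝ, 0 < C ∧ ∀ (R : ℝ), ∀ x : EuclideanSpace ℝ (Fin n),
      ∃ G : EuclideanSpace ℝ (Fin n) → ℝ, Integrable G ∧
        (∀ z, jb z ^ (-N) * jbr (‖x - z‖ - R) ^ (-β) * ‖x - z‖ ^ (-γ) ≤ G z) ∧
        ∫ z, G z ≤ C * (jbr (R - ‖x‖) ^ (-β) * jb x ^ (-γ)) := by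
  obtain ⟨C, hC, H⟩ := aux_key n hn β hβ γ hγ0 hγ
  refine ⟨(1 / 2) ^ (-(n + β)) * (2 * C * (1 / 2) ^ (-β)), by positivity, ?_⟩
  intro R x
  set d := jbr (R - ‖x‖) with hd
  have hd1 : 1 ≤ d := one_le_jbr _
  obtain ⟨G1, i1, b1, e1⟩ := H 1 (by norm_num) x
  obtain ⟨G2, i2, b2, e2⟩ := H (d / 2) (by linarith) x
  refine ⟨fun z => (1 / 2) ^ (-(n + β)) * ((d / 2) ^ (-β) * G1 z + G2 z),
    ((i1.const_mul _).add i2).const_mul _, ?_, ?_⟩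
  · intro z
    set u := jbr (‖x - z‖ - R) with hu
    have hu1 : 1 ≤ u := one_le_jbr _
    have hz1 : 1 ≤ jb z := one_le_jbr _
    have hz2 : ‖z‖ ≤ jb z := by simpa [jb_eq] using abs_le_jbr ‖z‖
    have h1 : d ≤ u + ‖z‖ := by
      apply jbr_le_of_abs_le (norm_nonneg _)
      have := abs_norm_sub_norm_le x (x - z)
      rw [sub_sub_cancel] at this
      have h2 := abs_add_le (‖x‖ - ‖x - z‖) (‖x - z‖ - R)
      rw [abs_sub_comm]
      rw [show ‖x‖ - ‖x - z‖ + (‖x - z‖ - R) = ‖x‖ - R by ring] at h2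
      linarith
    have hzN : jb z ^ (-N) ≤ jb z ^ (-(n + β)) :=
      Real.rpow_le_rpow_of_exponent_le hz1 (by linarith)
    have hy : 0 ≤ ‖x - z‖ ^ (-γ) := by positivity
    have hn0 : -((n : ℝ) + β) ≤ 0 := by
      have : (0 : ℝ) ≤ n := by positivity
      linarith
    have key : ∀ l : ℝ, 0 < l → l ≤ jb z →
        jb z ^ (-N) ≤ (1 / 2) ^ (-(n + β)) * (l + ‖z‖) ^ (-(n + β)) := by
      intro l hl hlz
      refine hzN.trans ?_
      rw [← Real.mul_rpow (by norm_num) (by positivity)]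
      apply Real.rpow_le_rpow_of_nonpos (by positivity) (by linarith) hn0
    have g1 : 0 ≤ G1 z := le_trans (by positivity) (b1 z)
    have g2 : 0 ≤ G2 z := le_trans (by positivity) (b2 z)
    have hz0 : 0 < jb z := by linarith
    rcases le_total (d / 2) u with h | h
    · have k1 := key 1 one_pos hz1
      have k2 : u ^ (-β) ≤ (d / 2) ^ (-β) :=
        Real.rpow_le_rpow_of_nonpos (by positivity) h (by linarith)
      calc _ ≤ ((1 / 2) ^ (-(n + β)) * (1 + ‖z‖) ^ (-(n + β))) * (d / 2) ^ (-β)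
            * ‖x - z‖ ^ (-γ) := by gcongr
        _ = (1 / 2) ^ (-(n + β)) * ((d / 2) ^ (-β) *
            ((1 + ‖z‖) ^ (-(n + β)) * ‖x - z‖ ^ (-γ))) := by ring
        _ ≤ (1 / 2) ^ (-(n + β)) * ((d / 2) ^ (-β) * G1 z) := by
            have := b1 z
            gcongr
        _ ≤ _ := by beta_reduce; gcongr; linarith
    · have k1 := key (d / 2) (by positivity) (by linarith)
      have k2 : u ^ (-β) ≤ 1 := Real.rpow_le_one_of_one_le_of_nonpos hu1 (by linarith)
      calc _ ≤ ((1 / 2) ^ (-(n + β)) * (d / 2 + ‖z‖) ^ (-(n + β))) * 1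
            * ‖x - z‖ ^ (-γ) := by gcongr
        _ = (1 / 2) ^ (-(n + β)) * ((d / 2 + ‖z‖) ^ (-(n + β)) * ‖x - z‖ ^ (-γ)) := by ring
        _ ≤ (1 / 2) ^ (-(n + β)) * G2 z := by
            have := b2 z
            gcongr
        _ ≤ _ := by
            beta_reduce
            gcongr
            have : 0 ≤ (d / 2) ^ (-β) * G1 z := by positivity
            linarith
  · rw [integral_const_mul, integral_add (i1.const_mul _) i2, integral_const_mul, mul_assoc]
    apply mul_le_mul_of_nonneg_left _ (by positivity)
    rw [Real.one_rpow, one_mul] at e1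
    have q1 : (d / 2) ^ (-β) = (1 / 2) ^ (-β) * d ^ (-β) := by
      rw [← Real.mul_rpow (by norm_num) (by positivity)]; congr 1; ring
    have hd0 : 0 ≤ (d / 2) ^ (-β) := by positivity
    have := mul_le_mul_of_nonneg_left e1 hd0
    calc _ ≤ (d / 2) ^ (-β) * (C * jb x ^ (-γ)) + C * ((d / 2) ^ (-β) * jb x ^ (-γ)) :=
          add_le_add this e2
      _ = _ := by rw [q1]; ring

theorem stmt_7 (n : ℕ) (hn : 2 ≤ n) (α β N : ℝ) (hβ : 1 ≤ β)
    (hα0 : 0 ≤ α) (hα : α < n - 1) (hN : (n : ℝ) + β ≤ N) :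
    ∃ C : ℝ, 0 < C ∧ ∀ x : EuclideanSpace ℝ (Fin n), ∀ R : ℝ, 0 ≤ R →
      (∫ z : EuclideanSpace ℝ (Fin n),
          jb z ^ (-N) / (‖x - z‖ ^ α * jbr (‖x - z‖ + R) * jbr (‖x - z‖ - R) ^ β)) ≤
        C / (jb x ^ α * jbr (‖x‖ + R) * jbr (R - ‖x‖) ^ β) := by
  obtain ⟨C1, hC1, H1⟩ := aux_H n (by omega) β (by linarith) α hα0 (by linarith) N hN
  obtain ⟨C2, hC2, H2⟩ := aux_H n (by omega) β (by linarith) (α + 1) (by linarith)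
    (by linarith) N hN
  have : Nonempty (Fin n) := ⟨⟨0, by omega⟩⟩
  refine ⟨2 * C1 + 2 * C2, by positivity, ?_⟩
  intro x R hR
  have hx0 : 0 < jb x := jbr_pos _
  have hS0 : 0 < jbr (‖x‖ + R) := jbr_pos _
  have hD0 : 0 < jbr (R - ‖x‖) := jbr_pos _
  have hrhs : ∀ K : ℝ, K / (jb x ^ α * jbr (‖x‖ + R) * jbr (R - ‖x‖) ^ β) =
      K * ((jbr (‖x‖ + R))⁻¹ * (jbr (R - ‖x‖) ^ (-β) * jb x ^ (-α))) := by
    intro K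
    rw [Real.rpow_neg hD0.le, Real.rpow_neg hx0.le, div_eq_mul_inv, mul_inv, mul_inv]
    ring
  have hlhs : ∀ z : EuclideanSpace ℝ (Fin n),
      jb z ^ (-N) / (‖x - z‖ ^ α * jbr (‖x - z‖ + R) * jbr (‖x - z‖ - R) ^ β) =
      (jbr (‖x - z‖ + R))⁻¹ * (jb z ^ (-N) * jbr (‖x - z‖ - R) ^ (-β) * ‖x - z‖ ^ (-α)) := by
    intro z
    rw [Real.rpow_neg (jbr_pos (‖x - z‖ - R)).le, Real.rpow_neg (norm_nonneg (x - z)),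
      div_eq_mul_inv, mul_inv, mul_inv]
    ring
  have hz0 : ∀ z : EuclideanSpace ℝ (Fin n), 0 < jb z := fun z => jbr_pos _
  have hnn : ∀ z : EuclideanSpace ℝ (Fin n), 0 ≤
      jb z ^ (-N) / (‖x - z‖ ^ α * jbr (‖x - z‖ + R) * jbr (‖x - z‖ - R) ^ β) := by
    intro z
    have := hz0 z
    have := jbr_pos (‖x - z‖ + R)
    have := jbr_pos (‖x - z‖ - R)
    positivity
  rw [hrhs]
  have hT : 0 ≤ (jbr (‖x‖ + R))⁻¹ * (jbr (R - ‖x‖) ^ (-β) * jb x ^ (-α)) := by positivity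
  have hxn := norm_nonneg x
  rcases le_total ‖x‖ R with h | h
  · obtain ⟨G, i, b, e⟩ := H1 R x
    calc _ ≤ ∫ z, 2 * (jbr (‖x‖ + R))⁻¹ * G z := by
          apply integral_mono_of_nonneg (Filter.Eventually.of_forall hnn) (i.const_mul _)
          refine Filter.Eventually.of_forall fun z => ?_
          dsimp only
          rw [hlhs]
          have p1 := hz0 z
          have p2 := jbr_pos (‖x - z‖ + R)
          have p3 := jbr_pos (‖x - z‖ - R)
          have p4 : jbr (‖x‖ + R) ≤ 2 * jbr (‖x - z‖ + R) := by
            apply jbr_two_mul_le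
            have := norm_nonneg (x - z)
            rw [abs_of_nonneg (by positivity), abs_of_nonneg (by positivity)]
            linarith
          have p5 : (jbr (‖x - z‖ + R))⁻¹ ≤ 2 * (jbr (‖x‖ + R))⁻¹ := by
            rw [← div_eq_mul_inv, inv_le_comm₀ p2 (by positivity), inv_div]
            linarith
          exact mul_le_mul p5 (b z) (by positivity) (by positivity)
      _ ≤ 2 * (jbr (‖x‖ + R))⁻¹ * (C1 * (jbr (R - ‖x‖) ^ (-β) * jb x ^ (-α))) := by
          rw [integral_const_mul]
          gcongr
      _ ≤ _ := by nlinarith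
  · obtain ⟨G, i, b, e⟩ := H2 R x
    calc _ ≤ ∫ z, G z := by
          apply integral_mono_of_nonneg (Filter.Eventually.of_forall hnn) i
          have hne : ∀ᵐ z : EuclideanSpace ℝ (Fin n), z ≠ x := by
            simp [ae_iff]
          filter_upwards [hne] with z hz
          rw [hlhs]
          have p1 := hz0 z
          have p2 := jbr_pos (‖x - z‖ + R)
          have p3 := jbr_pos (‖x - z‖ - R)
          have p0 : 0 < ‖x - z‖ := norm_pos_iff.2 (sub_ne_zero.2 hz.symm)
          have p5 : (jbr (‖x - z‖ + R))⁻¹ ≤ ‖x - z‖⁻¹ := by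
            apply inv_anti₀ p0
            have := abs_le_jbr (‖x - z‖ + R)
            have := le_abs_self (‖x - z‖ + R)
            linarith
          refine le_trans ?_ (b z)
          rw [show -(α + 1) = -1 + -α by ring, Real.rpow_add p0, Real.rpow_neg_one]
          calc _ ≤ ‖x - z‖⁻¹ * (jb z ^ (-N) * jbr (‖x - z‖ - R) ^ (-β) * ‖x - z‖ ^ (-α)) := by
                gcongr
            _ = _ := by ring
      _ ≤ C2 * (jbr (R - ‖x‖) ^ (-β) * jb x ^ (-(α + 1))) := e
      _ ≤ 2 * C2 * ((jbr (‖x‖ + R))⁻¹ * (jbr (R - ‖x‖) ^ (-β) * jb x ^ (-α))) := by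
          rw [show -(α + 1) = -1 + -α by ring, Real.rpow_add hx0, Real.rpow_neg_one]
          have p4 : jbr (‖x‖ + R) ≤ 2 * jb x := by
            apply jbr_two_mul_le
            rw [abs_of_nonneg (by positivity), abs_of_nonneg (by positivity)]
            linarith
          have p5 : (jb x)⁻¹ ≤ 2 * (jbr (‖x‖ + R))⁻¹ := by
            rw [← div_eq_mul_inv, inv_le_comm₀ hx0 (by positivity), inv_div]
            linarith
          calc _ ≤ C2 * (jbr (R - ‖x‖) ^ (-β) * (2 * (jbr (‖x‖ + R))⁻¹ * jb x ^ (-α))) := by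
                gcongr
            _ = _ := by ring
      _ ≤ _ := by nlinarith
end

section
/- Let Φ̃ : ℝ → ℝ be a smooth compactly supported function, let β > −1, and let M be a positive integer with M > β+1. Then there exists a constant C (depending only on Φ̃, β, M) such that for every function F : (0,∞) → ℂ which is M times continuously differentiable and satisfies |F^{(k)}(λ)| ≤ λ^{β−k} for all λ > 0 and all 0 ≤ k ≤ M, and for every ρ ∈ ℝ, one has |∫_0^∞ e^{iρλ} F(λ) Φ̃(λ) dλ| ≤ C⟨ρ⟩^{−β−1}. -/
open MeasureTheory Real
open scoped ENNReal

lemma aux_parts (R ε ρ : ℝ) (hε : 0 < ε) (hεR : ε ≤ R) (hρ : ρ ≠ 0) (u u' : ℝ → ℂ)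
    (hu : ∀ x, 0 < x → HasDerivAt u (u' x) x) (hu' : ContinuousOn u' (Set.Ioi 0)) (huR : u R = 0) :
    ‖∫ x in ε..R, Complex.exp (Complex.I * ρ * x) * u x‖ ≤
      |ρ|⁻¹ * (‖u ε‖ + ‖∫ x in ε..R, Complex.exp (Complex.I * ρ * x) * u' x‖) := by
  have hc : (Complex.I * ρ : ℂ) ≠ 0 := by simp [hρ]
  have hsub : Set.uIcc ε R ⊆ Set.Ioi 0 := by
    rw [Set.uIcc_of_le hεR]; intro x hx; exact lt_of_lt_of_le hε hx.1
  have hv : ∀ x : ℝ, HasDerivAt (fun x : ℝ => (Complex.I * ρ)⁻¹ * Complex.exp (Complex.I * ρ * x))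
      (Complex.exp (Complex.I * ρ * x)) x := by
    intro x
    have h1 : HasDerivAt (fun x : ℝ => Complex.I * ρ * (x : ℂ)) (Complex.I * ρ * 1) x :=
      (Complex.ofRealCLM.hasDerivAt (x := x)).const_mul _
    have h2 := (h1.cexp).const_mul ((Complex.I * ρ)⁻¹)
    rwa [mul_one, mul_comm (Complex.exp _), ← mul_assoc, inv_mul_cancel₀ hc, one_mul] at h2
  have key := intervalIntegral.integral_mul_deriv_eq_deriv_mul (a := ε) (b := R) (u := u) (u' := u')
    (v := fun x : ℝ => (Complex.I * ρ)⁻¹ * Complex.exp (Complex.I * ρ * x))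
    (v' := fun x : ℝ => Complex.exp (Complex.I * ρ * x))
    (fun x hx => hu x (hsub hx)) (fun x _ => hv x)
    ((hu'.mono hsub).intervalIntegrable) (Continuous.intervalIntegrable (by fun_prop) _ _)
  have e1 : ∫ x in ε..R, Complex.exp (Complex.I * ρ * x) * u x =
      ∫ x in ε..R, u x * Complex.exp (Complex.I * ρ * x) := by
    simp only [mul_comm]
  have e2 : ∫ x in ε..R, u' x * ((Complex.I * ρ)⁻¹ * Complex.exp (Complex.I * ρ * x)) =
      (Complex.I * ρ)⁻¹ * ∫ x in ε..R, Complex.exp (Complex.I * ρ * x) * u' x := by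
    rw [← intervalIntegral.integral_const_mul]
    congr 1; ext x; ring
  have hexp : ‖Complex.exp (Complex.I * ρ * ε)‖ = 1 := by
    rw [Complex.norm_exp]; simp
  have hn : ‖(Complex.I * ρ : ℂ)⁻¹‖ = |ρ|⁻¹ := by simp
  rw [e1, key, e2, huR]
  refine (norm_sub_le _ _).trans ?_
  rw [zero_mul, zero_sub, norm_neg, norm_mul, norm_mul, norm_mul, hexp, hn]
  apply le_of_eq; ring

lemma aux_iter (A R β ρ : ℝ) (M : ℕ) (hA : 0 ≤ A) (hρ : 1 ≤ |ρ|) (hR : 1 ≤ R) (g : ℕ → ℝ → ℂ)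
    (hg : ∀ k < M, ∀ x, 0 < x → HasDerivAt (g k) (g (k+1) x) x)
    (hgc : ∀ k ≤ M, ContinuousOn (g k) (Set.Ioi 0))
    (hgb : ∀ k ≤ M, ∀ x, 0 < x → ‖g k x‖ ≤ A * x ^ (β - k))
    (hgR : ∀ k ≤ M, g k R = 0) (m : ℕ) (hm : m ≤ M) :
    ‖∫ x in (|ρ|⁻¹)..R, Complex.exp (Complex.I * ρ * x) * g 0 x‖ ≤
      m * (A * |ρ| ^ (-(β + 1))) +
        (|ρ|⁻¹)^m * ‖∫ x in (|ρ|⁻¹)..R, Complex.exp (Complex.I * ρ * x) * g m x‖ := by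
  have hρ0 : 0 < |ρ| := by linarith
  have hε : 0 < |ρ|⁻¹ := by positivity
  have hεR : |ρ|⁻¹ ≤ R := (inv_le_one_of_one_le₀ hρ).trans hR
  induction m with
  | zero => simp
  | succ m ih =>
    refine (ih (by omega)).trans ?_
    have h := aux_parts R _ ρ hε hεR (abs_pos.mp hρ0) (g m) (g (m+1)) (hg m (by omega))
      (hgc _ hm) (hgR m (by omega))
    have h2 := hgb m (by omega) _ hε
    have h3 : (|ρ|⁻¹)^(m+1) * (A * (|ρ|⁻¹) ^ (β - m)) = A * |ρ| ^ (-(β + 1)) := by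
      rw [← Real.rpow_natCast, Real.inv_rpow hρ0.le, Real.inv_rpow hρ0.le, ← Real.rpow_neg hρ0.le,
        ← Real.rpow_neg hρ0.le, mul_left_comm, ← Real.rpow_add hρ0]
      congr 2; push_cast; ring
    have hp : 0 ≤ (|ρ|⁻¹)^m := by positivity
    have h4 := mul_le_mul_of_nonneg_left h hp
    have h5 := mul_le_mul_of_nonneg_left h2 (pow_nonneg hε.le (m+1))
    rw [h3] at h5
    push_cast
    have e : (|ρ|⁻¹)^m * (|ρ|⁻¹ * (‖g m |ρ|⁻¹‖ + ‖∫ x in (|ρ|⁻¹)..R, Complex.exp (Complex.I * ρ * x) * g (m+1) x‖)) = (|ρ|⁻¹)^(m+1) * ‖g m |ρ|⁻¹‖ + (|ρ|⁻¹)^(m+1) * ‖∫ x in (|ρ|⁻¹)..R, Complex.exp (Complex.I * ρ * x) * g (m+1) x‖ := by ring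
    rw [e] at h4
    linarith

lemma aux_norm (ρ x : ℝ) (z : ℂ) : ‖Complex.exp (Complex.I * ρ * x) * z‖ = ‖z‖ := by
  rw [norm_mul, Complex.norm_exp]; simp

lemma aux_small (A β ρ b : ℝ) (hβ : -1 < β) (hb : 0 ≤ b) (g : ℝ → ℂ)
    (hgb : ∀ x, 0 < x → ‖g x‖ ≤ A * x ^ β) :
    ‖∫ x in (0:ℝ)..b, Complex.exp (Complex.I * ρ * x) * g x‖ ≤ A * (b ^ (β+1) / (β+1)) := by
  have h := intervalIntegral.norm_integral_le_of_norm_le (a := 0) (b := b) (μ := volume)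
    (f := fun x : ℝ => Complex.exp (Complex.I * ρ * x) * g x) (g := fun x => A * x ^ β) hb
    (Filter.Eventually.of_forall (fun x hx => by rw [aux_norm]; exact hgb x hx.1))
    ((intervalIntegral.intervalIntegrable_rpow' hβ).const_mul A)
  rw [intervalIntegral.integral_const_mul, integral_rpow (Or.inl hβ),
    Real.zero_rpow (by linarith), sub_zero] at h
  exact h

lemma aux_large (A β ρ ε R : ℝ) (M : ℕ) (hA : 0 ≤ A) (hM : β + 1 < M) (hε : 0 < ε) (hεR : ε ≤ R)
    (g : ℝ → ℂ) (hgb : ∀ x, 0 < x → ‖g x‖ ≤ A * x ^ (β - M)) :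
    ‖∫ x in ε..R, Complex.exp (Complex.I * ρ * x) * g x‖ ≤
      A * (ε ^ (β - M + 1) / (M - β - 1)) := by
  have h0 : (0:ℝ) ∉ Set.uIcc ε R := by
    rw [Set.uIcc_of_le hεR]; intro h; exact absurd h.1 (not_le.mpr hε)
  have h := intervalIntegral.norm_integral_le_of_norm_le (a := ε) (b := R) (μ := volume)
    (f := fun x : ℝ => Complex.exp (Complex.I * ρ * x) * g x) (g := fun x => A * x ^ (β - M)) hεR
    (Filter.Eventually.of_forall (fun x hx => by rw [aux_norm]; exact hgb x (hε.trans hx.1)))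
    ((intervalIntegral.intervalIntegrable_rpow (Or.inr h0)).const_mul A)
  rw [intervalIntegral.integral_const_mul, integral_rpow (Or.inr ⟨by linarith, h0⟩)] at h
  refine h.trans (mul_le_mul_of_nonneg_left ?_ hA)
  have hR : 0 ≤ R ^ (β - M + 1) := Real.rpow_nonneg (by linarith) _
  have e : (R ^ (β - M + 1) - ε ^ (β - M + 1)) / (β - M + 1) =
    (ε ^ (β - M + 1) - R ^ (β - M + 1)) / (M - β - 1) := by
    rw [← neg_div_neg_eq]; congr 1 <;> ring
  rw [e]
  apply div_le_div_of_nonneg_right _ (by linarith)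
  linarith

lemma aux_Phi (Φ : ℝ → ℝ) (hΦsmooth : ContDiff ℝ (⊤ : ℕ∞) Φ) (hΦsupp : HasCompactSupport Φ)
    (M : ℕ) : ∃ D R : ℝ, 0 < D ∧ 1 ≤ R ∧
      (∀ k ≤ M, ∀ x, 0 < x → ‖iteratedFDerivWithin ℝ k (fun x => (Φ x : ℂ)) (Set.Ioi 0) x‖ ≤
        D * x ^ (-(k:ℝ))) ∧
      (∀ k x, R ≤ x → iteratedFDerivWithin ℝ k (fun x => (Φ x : ℂ)) (Set.Ioi 0) x = 0) := by
  have hs : ContDiff ℝ (⊤ : ℕ∞) (fun x => (Φ x : ℂ)) := Complex.ofRealCLM.contDiff.comp hΦsmooth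
  have hc : HasCompactSupport (fun x => (Φ x : ℂ)) := hΦsupp.comp_left (g := Complex.ofReal) (by simp)
  have hw : ∀ k : ℕ, ∀ x, 0 < x → iteratedFDerivWithin ℝ k (fun x => (Φ x : ℂ)) (Set.Ioi 0) x =
      iteratedFDeriv ℝ k (fun x => (Φ x : ℂ)) x := fun k x hx =>
    iteratedFDerivWithin_of_isOpen k isOpen_Ioi hx
  have hb : ∀ k : ℕ, ∃ D : ℝ, ∀ x : ℝ, ‖x ^ k * ‖iteratedFDeriv ℝ k (fun x => (Φ x : ℂ)) x‖‖ ≤ D := by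
    intro k
    have h1 : HasCompactSupport (fun x : ℝ => x ^ k * ‖iteratedFDeriv ℝ k (fun x => (Φ x : ℂ)) x‖) :=
      HasCompactSupport.mul_left (f := fun x : ℝ => x ^ k) (hc.iteratedFDeriv k).norm
    have h2 : Continuous (iteratedFDeriv ℝ k (fun x => (Φ x : ℂ))) :=
      hs.continuous_iteratedFDeriv (by exact_mod_cast le_top)
    exact h1.exists_bound_of_continuous ((continuous_pow k).mul h2.norm)
  choose D hD using hb
  obtain ⟨R, hR⟩ := hc.isCompact.isBounded.subset_ball 0
  refine ⟨1 + ∑ k ∈ Finset.range (M+1), |D k|, max R 1, by positivity, le_max_right _ _, ?_, ?_⟩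
  · intro k hk x hx
    rw [hw k x hx]
    have h := hD k x
    rw [norm_mul, norm_norm, norm_pow, Real.norm_of_nonneg hx.le] at h
    have h1 : |D k| ≤ ∑ k ∈ Finset.range (M+1), |D k| :=
      Finset.single_le_sum (f := fun k => |D k|) (fun _ _ => abs_nonneg _)
        (Finset.mem_range.mpr (by omega))
    rw [Real.rpow_neg hx.le, Real.rpow_natCast, ← div_eq_mul_inv, le_div_iff₀ (by positivity)]
    have := le_abs_self (D k)
    linarith
  · intro k x hx
    have hx1 : 1 ≤ x := (le_max_right _ _).trans hx
    have hxR : R ≤ x := (le_max_left _ _).trans hx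
    rw [hw k x (by linarith)]
    by_contra hne
    have := hR (support_iteratedFDeriv_subset k hne)
    rw [mem_ball_zero_iff, Real.norm_eq_abs] at this
    have := le_abs_self x
    linarith

lemma aux_jbr (β ρ s : ℝ) (hβ : -1 < β) (hs : 0 < s) (h : jbr ρ ≤ 2 * s) :
    s ^ (-(β+1)) ≤ 2 ^ (β+1) * jbr ρ ^ (-(β+1)) := by
  have h0 : 0 < jbr ρ := Real.sqrt_pos.mpr (by positivity)
  have h1 := Real.rpow_le_rpow_of_nonpos h0 h (z := -(β+1)) (by linarith)
  rw [Real.mul_rpow (by norm_num) hs.le] at h1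
  have h2 := mul_le_mul_of_nonneg_left h1 (Real.rpow_nonneg (show (0:ℝ) ≤ 2 by norm_num) (β+1))
  rwa [← mul_assoc, ← Real.rpow_add (by norm_num), add_neg_cancel, Real.rpow_zero, one_mul] at h2

theorem stmt_10 (Φ : ℝ → ℝ) (hΦsmooth : ContDiff ℝ (⊤ : ℕ∞) Φ) (hΦsupp : HasCompactSupport Φ)
    (β : ℝ) (hβ : -1 < β) (M : ℕ) (hM0 : 0 < M) (hM : β + 1 < M) :
    ∃ C : ℝ, 0 < C ∧ ∀ F : ℝ → ℂ,
      ContDiffOn ℝ M F (Set.Ioi 0) →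
      (∀ k : ℕ, k ≤ M → ∀ lam : ℝ, 0 < lam →
        ‖iteratedDerivWithin k F (Set.Ioi 0) lam‖ ≤ lam ^ (β - k)) →
      ∀ ρ : ℝ,
        ‖∫ lam in Set.Ioi (0:ℝ), Complex.exp (Complex.I * ρ * lam) * F lam * (Φ lam : ℂ)‖ ≤
          C * jbr ρ ^ (-(β + 1)) := by
  obtain ⟨D, R, hD, hR, hDb, hDR⟩ := aux_Phi Φ hΦsmooth hΦsupp M
  have hβ1 : 0 < β + 1 := by linarith
  have hMβ : 0 < M - β - 1 := by linarith
  have hRp : 0 < R ^ (β+1) := Real.rpow_pos_of_pos (by linarith) _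
  set A : ℝ := 2 ^ M * D with hAdef
  have hA : 0 < A := by positivity
  have hT : 0 < A * (R ^ (β+1) / (β+1)) := by positivity
  have hT2 : 0 < A * (1 / (β+1)) + M * A + A * (1 / (M - β - 1)) := by positivity
  refine ⟨(A * (R ^ (β+1) / (β+1)) + (A * (1 / (β+1)) + M * A + A * (1 / (M - β - 1)))) * 2 ^ (β+1),
    by positivity, ?_⟩
  intro F hF hFb ρ
  have hs : ContDiff ℝ (⊤ : ℕ∞) (fun x => (Φ x : ℂ)) := Complex.ofRealCLM.contDiff.comp hΦsmooth
  have hsM : ContDiffOn ℝ M (fun x => (Φ x : ℂ)) (Set.Ioi 0) :=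
    (hs.of_le (by exact_mod_cast le_top)).contDiffOn
  have hud : UniqueDiffOn ℝ (Set.Ioi (0:ℝ)) := isOpen_Ioi.uniqueDiffOn
  have hG : ContDiffOn ℝ M (fun x => F x * (Φ x : ℂ)) (Set.Ioi 0) := hF.mul hsM
  let g : ℕ → ℝ → ℂ := fun k => iteratedDerivWithin k (fun x => F x * (Φ x : ℂ)) (Set.Ioi 0)
  have g0 : g 0 = fun x => F x * (Φ x : ℂ) := by simp [g]
  have hL : ∀ k ≤ M, ∀ x, 0 < x → ‖g k x‖ ≤ ∑ i ∈ Finset.range (k + 1),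
      (k.choose i : ℝ) * ‖iteratedFDerivWithin ℝ i F (Set.Ioi 0) x‖ *
        ‖iteratedFDerivWithin ℝ (k - i) (fun x => (Φ x : ℂ)) (Set.Ioi 0) x‖ := by
    intro k hk x hx
    simp only [g]
    rw [← norm_iteratedFDerivWithin_eq_norm_iteratedDerivWithin]
    exact norm_iteratedFDerivWithin_mul_le hF hsM hud hx (by exact_mod_cast hk)
  have hgb : ∀ k ≤ M, ∀ x, 0 < x → ‖g k x‖ ≤ A * x ^ (β - k) := by
    intro k hk x hx
    have hxp : 0 < x ^ (β - k) := Real.rpow_pos_of_pos hx _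
    calc ‖g k x‖ ≤ _ := hL k hk x hx
      _ ≤ ∑ i ∈ Finset.range (k + 1), (k.choose i : ℝ) * (D * x ^ (β - k)) := by
        apply Finset.sum_le_sum
        intro i hi
        have hik : i ≤ k := by have := Finset.mem_range.mp hi; omega
        have h1 := hFb i (by omega) x hx
        rw [← norm_iteratedFDerivWithin_eq_norm_iteratedDerivWithin] at h1
        have h2 := hDb (k - i) (by omega) x hx
        have h3 := mul_le_mul h1 h2 (norm_nonneg _) (by positivity)
        have e : x ^ (β - i) * (D * x ^ (-((k - i : ℕ) : ℝ))) = D * x ^ (β - k) := by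
          rw [mul_left_comm, ← Real.rpow_add hx, Nat.cast_sub hik]
          congr 2; ring
        rw [e] at h3
        rw [mul_assoc]
        exact mul_le_mul_of_nonneg_left h3 (by positivity)
      _ = 2 ^ k * (D * x ^ (β - k)) := by
        rw [← Finset.sum_mul]
        congr 1
        exact_mod_cast Nat.sum_range_choose k
      _ ≤ A * x ^ (β - k) := by
        rw [hAdef, mul_assoc]
        apply mul_le_mul_of_nonneg_right _ (by positivity)
        exact pow_le_pow_right₀ (by norm_num) hk
  have hgR : ∀ k ≤ M, ∀ x, R ≤ x → g k x = 0 := by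
    intro k hk x hx
    have := hL k hk x (by linarith)
    rw [Finset.sum_eq_zero (fun i _ => by rw [hDR (k-i) x hx]; simp)] at this
    exact norm_le_zero_iff.mp this
  have hgc : ∀ k ≤ M, ContinuousOn (g k) (Set.Ioi 0) := fun k hk =>
    hG.continuousOn_iteratedDerivWithin (by exact_mod_cast hk) hud
  have hgd : ∀ k < M, ∀ x, 0 < x → HasDerivAt (g k) (g (k+1) x) x := by
    intro k hk x hx
    have h := (hG.differentiableOn_iteratedDerivWithin (m := k) (by exact_mod_cast hk) hud) x hx
    have h2 := h.hasDerivWithinAt.hasDerivAt (Ioi_mem_nhds hx)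
    simp only [g]
    rw [iteratedDerivWithin_succ]
    exact h2
  have hgb0 : ∀ x, 0 < x → ‖g 0 x‖ ≤ A * x ^ β := by
    intro x hx; simpa using hgb 0 (by omega) x hx
  have hint : ∫ lam in Set.Ioi (0:ℝ), Complex.exp (Complex.I * ρ * lam) * F lam * (Φ lam : ℂ) =
      ∫ x in (0:ℝ)..R, Complex.exp (Complex.I * ρ * x) * g 0 x := by
    rw [intervalIntegral.integral_of_le (by linarith), g0]
    simp only [← mul_assoc]
    refine (setIntegral_eq_of_subset_of_forall_sdiff_eq_zero measurableSet_Ioi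
      Set.Ioc_subset_Ioi_self ?_)
    intro x hx
    have hxR : R ≤ x := by
      by_contra hlt
      exact hx.2 ⟨hx.1, (not_le.mp hlt).le⟩
    have := hgR 0 (by omega) x hxR
    simp only [g0] at this
    rw [mul_assoc, this, mul_zero]
  rw [hint]
  have hj0 : 0 < jbr ρ := Real.sqrt_pos.mpr (by positivity)
  rcases le_total |ρ| 1 with hρ | hρ
  · have h := aux_small A β ρ R hβ (by linarith) (g 0) hgb0
    have hj : jbr ρ ≤ 2 * 1 := by
      apply Real.sqrt_le_iff.mpr
      refine ⟨by norm_num, ?_⟩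
      rw [← sq_abs]; nlinarith [abs_nonneg ρ]
    have h2 := aux_jbr β ρ 1 hβ one_pos hj
    rw [Real.one_rpow] at h2
    rw [mul_assoc]
    nlinarith
  · have hρ0 : 0 < |ρ| := by linarith
    have hε : 0 < |ρ|⁻¹ := by positivity
    have hεR : |ρ|⁻¹ ≤ R := (inv_le_one_of_one_le₀ hρ).trans hR
    have hj : jbr ρ ≤ 2 * |ρ| := by
      apply Real.sqrt_le_iff.mpr
      refine ⟨by positivity, ?_⟩
      rw [← sq_abs]; nlinarith [abs_nonneg ρ]
    have h2 := aux_jbr β ρ |ρ| hβ hρ0 hj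
    have hii : ∀ b, 0 ≤ b → IntervalIntegrable (fun x : ℝ => Complex.exp (Complex.I * ρ * x) * g 0 x)
        volume 0 b := by
      intro b hb
      refine ((intervalIntegral.intervalIntegrable_rpow' hβ).const_mul A).mono_fun' ?_ ?_
      · rw [Set.uIoc_of_le hb]
        refine ContinuousOn.aestronglyMeasurable ?_ measurableSet_Ioc
        refine ContinuousOn.mul (Continuous.continuousOn (by fun_prop)) ?_
        exact (hgc 0 (by omega)).mono Set.Ioc_subset_Ioi_self
      · rw [Set.uIoc_of_le hb]
        refine (ae_restrict_iff' measurableSet_Ioc).mpr (Filter.Eventually.of_forall ?_)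
        intro x hx
        exact (aux_norm ρ x (g 0 x)).le.trans (hgb0 x hx.1)
    rw [← intervalIntegral.integral_add_adjacent_intervals (hii _ hε.le)
      ((hii _ hε.le).symm.trans (hii R (by linarith)))]
    have a1 := aux_small A β ρ |ρ|⁻¹ hβ hε.le (g 0) hgb0
    have a2 := aux_iter A R β ρ M hA.le hρ hR g hgd hgc hgb (fun k hk => hgR k hk R le_rfl) M le_rfl
    have a3 := aux_large A β ρ |ρ|⁻¹ R M hA.le hM hε hεR (g M) (hgb M le_rfl)
    have a4 := mul_le_mul_of_nonneg_left a3 (pow_nonneg hε.le M)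
    have e1 : (|ρ|⁻¹) ^ (β+1) = |ρ| ^ (-(β+1)) := by
      rw [Real.inv_rpow hρ0.le, Real.rpow_neg hρ0.le]
    have e2 : (|ρ|⁻¹) ^ M * (A * ((|ρ|⁻¹) ^ (β - M + 1) / (M - β - 1))) =
        A * (1 / (M - β - 1)) * |ρ| ^ (-(β+1)) := by
      rw [← e1, show β + 1 = M + (β - M + 1) by ring, Real.rpow_add hε (M:ℝ) (β - M + 1), Real.rpow_natCast]
      ring
    rw [e1] at a1
    rw [e2] at a4
    set P := |ρ| ^ (-(β+1))
    have hP : 0 < P := Real.rpow_pos_of_pos hρ0 _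
    refine (norm_add_le _ _).trans ?_
    have b1 : A * (P / (β+1)) = A * (1/(β+1)) * P := by ring
    rw [b1] at a1
    refine (add_le_add a1 (a2.trans (add_le_add_right a4 _))).trans ?_
    have b3 : A * (1/(β+1)) * P + (M * (A * P) + A * (1 / (M - β - 1)) * P) =
        (A * (1 / (β+1)) + M * A + A * (1 / (M - β - 1))) * P := by ring
    rw [b3]
    refine (mul_le_mul_of_nonneg_left h2 hT2.le).trans ?_
    clear_value A
    rw [← mul_assoc]
    apply mul_le_mul_of_nonneg_right _ (by positivity)
    apply mul_le_mul_of_nonneg_right _ (by positivity)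
    linarith
end

section
/- Let Φ̃ : ℝ → ℝ be a smooth compactly supported function, let β > −1, and let M be a positive integer with M > β+1. Then there exists a constant C (depending only on Φ̃, β, M) such that the following holds: for every ρ > 0 and every L with L > 1/ρ and 0 < L ≤ 1, and every smooth function F : (0,∞) → ℂ supported in the interval [L, 1] and satisfying |F^{(k)}(λ)| ≤ λ^{β−k} for all λ > 0 and all 0 ≤ k ≤ M, one has |∫_0^∞ e^{iρλ} F(λ) Φ̃(λ) dλ| ≤ C⟨ρ⟩^{−M} L^{β+1−M}. -/
open MeasureTheory Real
open scoped ENNReal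

theorem aux_rpow_integral (L a : ℝ) (hL : 0 < L) (hL1 : L ≤ 1) (ha : a + 1 < 0) :
    IntegrableOn (fun x : ℝ => x ^ a) (Set.Icc L 1) ∧
      ∫ x in Set.Icc L 1, x ^ a ≤ L ^ (a + 1) / (-(a + 1)) := by
  refine ⟨?_, ?_⟩
  · apply ContinuousOn.integrableOn_Icc
    intro x hx
    exact (Real.continuousAt_rpow_const x a
      (Or.inl (lt_of_lt_of_le hL hx.1).ne')).continuousWithinAt
  · rw [integral_Icc_eq_integral_Ioc, ← intervalIntegral.integral_of_le hL1, integral_rpow]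
    · rw [Real.one_rpow, ← neg_div_neg_eq]
      gcongr
      · linarith
      · linarith
    · right
      refine ⟨by linarith, ?_⟩
      rw [Set.uIcc_of_le hL1]
      intro h
      exact absurd h.1 (not_le.mpr hL)

theorem stmt_11 (Φ : ℝ → ℝ) (hΦsmooth : ContDiff ℝ (⊤ : ℕ∞) Φ) (hΦsupp : HasCompactSupport Φ)
    (β : ℝ) (hβ : -1 < β) (M : ℕ) (hM0 : 0 < M) (hM : β + 1 < M) :
    ∃ C : ℝ, 0 < C ∧ ∀ ρ L : ℝ, 0 < ρ → 1 / ρ < L → 0 < L → L ≤ 1 →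
      ∀ F : ℝ → ℂ,
        ContDiffOn ℝ (⊤ : ℕ∞) F (Set.Ioi 0) →
        (∀ lam : ℝ, lam ∉ Set.Icc L 1 → F lam = 0) →
        (∀ k : ℕ, k ≤ M → ∀ lam : ℝ, 0 < lam →
          ‖iteratedDerivWithin k F (Set.Ioi 0) lam‖ ≤ lam ^ (β - k)) →
        ‖∫ lam in Set.Ioi (0:ℝ), Complex.exp (Complex.I * ρ * lam) * F lam * (Φ lam : ℂ)‖ ≤
          C * jbr ρ ^ (-(M : ℝ)) * L ^ (β + 1 - M) := by
  have hB : ∀ j : ℕ, ∃ C, ∀ x, ‖iteratedFDeriv ℝ j Φ x‖ ≤ C := fun j =>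
    (hΦsmooth.continuous_iteratedFDeriv (m := j) (by exact_mod_cast le_top)).bounded_above_of_compact_support
      (hΦsupp.iteratedFDeriv j)
  choose b hb using hB
  have hb0 : ∀ j, 0 ≤ b j := fun j => (norm_nonneg _).trans (hb j 0)
  set S : ℝ := ∑ i ∈ Finset.range (M + 1), (M.choose i : ℝ) * b i + 1 with hS
  have hS0 : 0 < S := by
    have : 0 ≤ ∑ i ∈ Finset.range (M + 1), (M.choose i : ℝ) * b i :=
      Finset.sum_nonneg fun i _ => mul_nonneg (by positivity) (hb0 i)
    linarith
  have hd : 0 < (M : ℝ) - β - 1 := by linarith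
  refine ⟨(Real.sqrt 2) ^ M * S / (M - β - 1), by positivity, ?_⟩
  intro ρ L hρ hρL hL hL1 F hF hF0 hFb
  have hρ1 : 1 < ρ := by
    have := hρL.trans_le hL1
    rwa [div_lt_one hρ] at this
  -- F globally smooth
  have hFs : ContDiff ℝ (⊤ : ℕ∞) F := by
    rw [contDiff_iff_contDiffAt]
    intro x
    rcases lt_or_ge 0 x with hx | hx
    · exact hF.contDiffAt (Ioi_mem_nhds hx)
    · have : F =ᶠ[nhds x] fun _ => (0 : ℂ) := by
        filter_upwards [Iio_mem_nhds (lt_of_le_of_lt hx hL)] with y hy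
        exact hF0 y fun h => absurd h.1 (not_le.mpr hy)
      exact contDiffAt_const.congr_of_eventuallyEq this
  set g : ℝ → ℂ := fun y => Φ y • F y with hg
  have hgs : ContDiff ℝ (⊤ : ℕ∞) g := hΦsmooth.smul hFs
  have hg0 : ∀ x, x ∉ Set.Icc L 1 → g x = 0 := fun x hx => by simp [hg, hF0 x hx]
  have hgt : tsupport g ⊆ Set.Icc L 1 := by
    apply closure_minimal _ isClosed_Icc
    intro x hx
    by_contra h
    exact hx (hg0 x h)
  have hgc : HasCompactSupport g := isCompact_Icc.of_isClosed_subset (isClosed_tsupport g) hgt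
  have hgint : ∀ n : ℕ, Integrable (iteratedDeriv n g) := by
    intro n
    apply Continuous.integrable_of_hasCompactSupport
    · exact hgs.continuous_iteratedDeriv n (by exact_mod_cast le_top)
    · refine (hgc.iteratedFDeriv (𝕜 := ℝ) n).mono ?_
      intro x hx h
      apply hx
      rw [← norm_eq_zero, ← norm_iteratedFDeriv_eq_norm_iteratedDeriv, h, norm_zero]
  have hder0 : ∀ x, x ∉ Set.Icc L 1 → iteratedDeriv M g x = 0 := by
    intro x hx
    rw [← norm_eq_zero, ← norm_iteratedFDeriv_eq_norm_iteratedDeriv, norm_eq_zero]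
    by_contra h
    exact hx (hgt (support_iteratedFDeriv_subset M h))
  have hderb : ∀ x ∈ Set.Icc L 1, ‖iteratedDeriv M g x‖ ≤ S * x ^ (β - M) := by
    intro x hx
    have hx0 : 0 < x := hL.trans_le hx.1
    rw [← norm_iteratedFDeriv_eq_norm_iteratedDeriv]
    refine (norm_iteratedFDeriv_smul_le hΦsmooth hFs x (n := M) (by exact_mod_cast le_top)).trans ?_
    have hp : 0 ≤ x ^ (β - M) := by positivity
    calc _ ≤ ∑ i ∈ Finset.range (M + 1), (M.choose i : ℝ) * b i * x ^ (β - M) := by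
          apply Finset.sum_le_sum
          intro i hi
          have h1 : ‖iteratedFDeriv ℝ (M - i) F x‖ ≤ x ^ (β - M) := by
            rw [norm_iteratedFDeriv_eq_norm_iteratedDeriv,
              ← iteratedDerivWithin_of_isOpen isOpen_Ioi (Set.mem_Ioi.mpr hx0)]
            refine (hFb (M - i) (Nat.sub_le _ _) x hx0).trans ?_
            apply Real.rpow_le_rpow_of_exponent_ge hx0 hx.2
            have : ((M - i : ℕ) : ℝ) ≤ M := by exact_mod_cast Nat.sub_le _ _
            linarith
          have := hb i x
          have := hb0 i
          gcongr
      _ = (S - 1) * x ^ (β - M) := by rw [← Finset.sum_mul, hS]; ring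
      _ ≤ S * x ^ (β - M) := by nlinarith
  obtain ⟨hI1, hI2⟩ := aux_rpow_integral L (β - M) hL hL1 (by linarith)
  -- the Fourier transform
  set w : ℝ := -ρ / (2 * π) with hw
  have hint : ∫ lam in Set.Ioi (0:ℝ), Complex.exp (Complex.I * ρ * lam) * F lam * (Φ lam : ℂ)
      = FourierTransform.fourier g w := by
    rw [setIntegral_eq_integral_of_forall_compl_eq_zero, Real.fourier_real_eq_integral_exp_smul]
    · congr 1
      ext x
      have h1 : -2 * π * x * w = ρ * x := by
        rw [hw]; field_simp
      rw [h1, hg]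
      simp only [smul_eq_mul, Complex.real_smul, Complex.ofReal_mul]
      rw [show Complex.I * (ρ : ℂ) * x = ρ * x * Complex.I by ring]
      ring
    · intro x hx
      rw [hF0 x fun h => hx (hL.trans_le h.1)]
      simp
  have hFT := congrFun (Real.fourier_iteratedDeriv (f := g) (N := (⊤ : ℕ∞)) (n := M) hgs
    (fun n _ => hgint n) le_top) w
  have hnorm : ρ ^ M * ‖FourierTransform.fourier g w‖
      = ‖FourierTransform.fourier (iteratedDeriv M g) w‖ := by
    rw [hFT, norm_smul, norm_pow]
    congr 2
    have h2 : (2 * (π : ℂ) * Complex.I * (w : ℂ)) = ((-ρ : ℝ) : ℂ) * Complex.I := by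
      rw [hw]
      push_cast
      have : (π : ℂ) ≠ 0 := by exact_mod_cast Real.pi_ne_zero
      field_simp
    rw [h2]
    simp [abs_of_pos hρ]
  have hbd : ‖FourierTransform.fourier (iteratedDeriv M g) w‖
      ≤ S * (L ^ (β - M + 1) / (-(β - M + 1))) := by
    rw [Real.fourier_real_eq_integral_exp_smul,
      ← setIntegral_eq_integral_of_forall_compl_eq_zero (s := Set.Icc L 1)
        (fun x hx => by rw [hder0 x hx, smul_zero])]
    refine (norm_integral_le_of_norm_le (hI1.const_mul S) ?_).trans ?_
    · filter_upwards [ae_restrict_mem measurableSet_Icc] with x hx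
      rw [norm_smul, Complex.norm_exp_ofReal_mul_I, one_mul]
      exact hderb x hx
    · rw [integral_const_mul]
      gcongr
  have hj0 : 0 < jbr ρ := Real.sqrt_pos.mpr (by positivity)
  have hj : jbr ρ ≤ Real.sqrt 2 * ρ := by
    rw [jbr, ← Real.sqrt_sq hρ.le, ← Real.sqrt_mul (by norm_num), Real.sqrt_sq hρ.le]
    apply Real.sqrt_le_sqrt
    nlinarith
  have hjM : jbr ρ ^ M ≤ Real.sqrt 2 ^ M * ρ ^ M := by
    rw [← mul_pow]
    gcongr
  rw [hint, Real.rpow_neg hj0.le, Real.rpow_natCast]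
  rw [show β + 1 - (M : ℝ) = β - M + 1 by ring]
  have hfin : jbr ρ ^ M * ‖FourierTransform.fourier g w‖
      ≤ Real.sqrt 2 ^ M * (S * (L ^ (β - M + 1) / (-(β - M + 1)))) := by
    calc _ ≤ Real.sqrt 2 ^ M * ρ ^ M * ‖FourierTransform.fourier g w‖ := by gcongr
      _ = Real.sqrt 2 ^ M * (ρ ^ M * ‖FourierTransform.fourier g w‖) := by ring
      _ ≤ _ := by rw [hnorm]; gcongr
  rw [show Real.sqrt 2 ^ M * S / (M - β - 1) * (jbr ρ ^ M)⁻¹ * L ^ (β - M + 1)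
    = (Real.sqrt 2 ^ M * (S * (L ^ (β - M + 1) / (-(β - M + 1))))) / jbr ρ ^ M by
      rw [show -(β - (M : ℝ) + 1) = M - β - 1 by ring]; ring]
  rw [le_div_iff₀ (by positivity)]
  linarith
end

section
/- Let ε > 0 and A > 0, and let g : ℝ⁴ → ℂ be a measurable function satisfying |g(y)| ≤ A⟨y⟩^{-5-ε} for all y ∈ ℝ⁴ and ∫_{ℝ⁴} g(y) dy = 0. Define ψ(x) = ∫_{ℝ⁴} g(y) |x−y|^{-2} dy (the integral converges absolutely for every x). Then there exists a constant C (depending only on ε) such that |ψ(x)| ≤ C·A·⟨x⟩^{-3} for all x ∈ ℝ⁴. -/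
open MeasureTheory Real
open scoped ENNReal

local notation "E4" => EuclideanSpace ℝ (Fin 4)

lemma jb_pos' (x : E4) : 0 < jb x := Real.sqrt_pos.2 (by positivity)

lemma jb_sq' (x : E4) : jb x ^ 2 = 1 + ‖x‖ ^ 2 := Real.sq_sqrt (by positivity)

lemma one_le_jb' (x : E4) : 1 ≤ jb x := by
  have := jb_sq' x
  nlinarith [jb_pos' x, sq_nonneg ‖x‖]

lemma norm_le_jb' (x : E4) : ‖x‖ ≤ jb x := by
  apply Real.le_sqrt_of_sq_le; linarith

lemma jb_integrable (ε : ℝ) (hε : 0 < ε) :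
    Integrable (fun y : E4 => jb y ^ (-(4 + ε))) := by
  have h := integrable_rpow_neg_one_add_norm_sq (E := E4) (μ := volume) (r := 4 + ε)
    (by simp; exact hε)
  refine h.congr (Filter.Eventually.of_forall fun y => ?_)
  simp only [jb]
  rw [Real.sqrt_eq_rpow, ← Real.rpow_mul (by positivity)]
  congr 1; ring

lemma q_integrable :
    Integrable (fun z : E4 => (Set.Iio (1:ℝ)).indicator (fun r => (r ^ 2)⁻¹) ‖z‖) := by
  rw [integrable_fun_norm_addHaar (μ := (volume : Measure E4))
    (f := (Set.Iio (1:ℝ)).indicator (fun r => (r ^ 2)⁻¹))]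
  have h1 : IntegrableOn (fun y : ℝ => y) (Set.Ioo 0 1) :=
    (continuous_id.integrableOn_Icc).mono_set Set.Ioo_subset_Icc_self
  have h2 : Integrable ((Set.Ioo (0:ℝ) 1).indicator (fun y : ℝ => y)) :=
    (integrable_indicator_iff measurableSet_Ioo).2 h1
  refine (h2.integrableOn (s := Set.Ioi 0)).congr_fun (fun y hy => ?_) measurableSet_Ioi
  simp only [Set.mem_Ioi] at hy
  by_cases h : y < 1
  · simp [Set.indicator, hy, h]
    field_simp
  · simp [Set.indicator, h]

lemma ker_bound (ε : ℝ) (hε : 0 < ε) (x y : E4) :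
    jb x ^ 2 * (jb y ^ (-(4 + ε)) * (‖x - y‖ ^ 2)⁻¹) ≤
      6 * jb y ^ (-(4 + ε)) + 4 * jb (x - y) ^ (-(4 + ε)) +
        2 * (Set.Iio (1:ℝ)).indicator (fun r => (r ^ 2)⁻¹) ‖x - y‖ := by
  set z := x - y with hz
  have hx : ‖x‖ ≤ ‖y‖ + ‖z‖ := by
    have : x = y + z := by simp [hz]
    rw [this]; exact norm_add_le _ _
  have hjx : jb x ^ 2 ≤ 2 * jb y ^ 2 + 2 * ‖z‖ ^ 2 := by
    rw [jb_sq', jb_sq']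
    nlinarith [norm_nonneg x, norm_nonneg y, norm_nonneg z, sq_nonneg (‖y‖ - ‖z‖)]
  have hy0 := jb_pos' y
  have hz0 := jb_pos' z
  have hh : 0 < jb y ^ (-(4 + ε)) := Real.rpow_pos_of_pos hy0 _
  have hhz : 0 < jb z ^ (-(4 + ε)) := Real.rpow_pos_of_pos hz0 _
  have hi : 0 ≤ (‖z‖ ^ 2)⁻¹ := by positivity
  have hsplit : ∀ w : E4, jb w ^ 2 * jb w ^ (-(4 + ε)) = jb w ^ (-(2 + ε)) := by
    intro w
    rw [← Real.rpow_natCast, ← Real.rpow_add (jb_pos' w)]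
    congr 1; push_cast; ring
  have hzz : ‖z‖ ^ 2 * (‖z‖ ^ 2)⁻¹ ≤ 1 := mul_inv_le_one
  have key : jb y ^ (-(2 + ε)) * (‖z‖ ^ 2)⁻¹ ≤
      2 * jb y ^ (-(4 + ε)) + 2 * jb z ^ (-(4 + ε)) +
        (Set.Iio (1:ℝ)).indicator (fun r => (r ^ 2)⁻¹) ‖z‖ := by
    by_cases hz1 : ‖z‖ < 1
    · have : (Set.Iio (1:ℝ)).indicator (fun r => (r ^ 2)⁻¹) ‖z‖ = (‖z‖ ^ 2)⁻¹ := by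
        simp [Set.indicator, hz1]
      rw [this]
      have h1 : jb y ^ (-(2 + ε)) ≤ 1 :=
        Real.rpow_le_one_of_one_le_of_nonpos (one_le_jb' y) (by linarith)
      nlinarith
    · have : (Set.Iio (1:ℝ)).indicator (fun r => (r ^ 2)⁻¹) ‖z‖ = 0 := by
        simp [Set.indicator, hz1]
      rw [this]
      push Not at hz1
      have h2 : (‖z‖ ^ 2)⁻¹ ≤ 2 * (jb z ^ 2)⁻¹ := by
        rw [jb_sq', ← div_eq_mul_inv, inv_eq_one_div, div_le_div_iff₀ (by positivity) (by positivity)]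
        nlinarith
      have h3 : jb y ^ (-(2 + ε)) * (jb z ^ 2)⁻¹ ≤ jb y ^ (-(4 + ε)) + jb z ^ (-(4 + ε)) := by
        rcases le_total (jb y) (jb z) with hle | hle
        · have : jb y ^ (-(2 + ε)) * (jb z ^ 2)⁻¹ ≤ jb y ^ (-(4 + ε)) := by
            rw [← hsplit y, ← div_eq_mul_inv, div_le_iff₀ (by positivity), mul_comm]
            gcongr
          linarith
        · have h4 : jb y ^ (-(2 + ε)) ≤ jb z ^ (-(2 + ε)) :=
            Real.rpow_le_rpow_of_nonpos hz0 hle (by linarith)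
          have : jb y ^ (-(2 + ε)) * (jb z ^ 2)⁻¹ ≤ jb z ^ (-(4 + ε)) := by
            rw [← div_eq_mul_inv, div_le_iff₀ (by positivity), mul_comm, hsplit]
            exact h4
          linarith
      have h5 : 0 < jb y ^ (-(2 + ε)) := Real.rpow_pos_of_pos hy0 _
      nlinarith
  rw [← hsplit y] at key
  have e1 : jb x ^ 2 * (jb y ^ (-(4 + ε)) * (‖z‖ ^ 2)⁻¹) ≤
      (2 * jb y ^ 2 + 2 * ‖z‖ ^ 2) * (jb y ^ (-(4 + ε)) * (‖z‖ ^ 2)⁻¹) := by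
    gcongr
  have e2 : (‖z‖ ^ 2 * (‖z‖ ^ 2)⁻¹) * jb y ^ (-(4 + ε)) ≤ 1 * jb y ^ (-(4 + ε)) := by
    gcongr
  nlinarith

lemma meas_ker (ε : ℝ) (x : E4) :
    Measurable (fun y : E4 => jb y ^ (-(4 + ε)) * (‖x - y‖ ^ 2)⁻¹) := by
  unfold jb; fun_prop

lemma ker_integral (ε : ℝ) (hε : 0 < ε) :
    ∃ K : ℝ, 0 ≤ K ∧ ∀ x : E4,
      Integrable (fun y : E4 => jb y ^ (-(4 + ε)) * (‖x - y‖ ^ 2)⁻¹) ∧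
      jb x ^ 2 * ∫ y : E4, jb y ^ (-(4 + ε)) * (‖x - y‖ ^ 2)⁻¹ ≤ K := by
  have hH := jb_integrable ε hε
  have hQ := q_integrable
  set h : E4 → ℝ := fun y => jb y ^ (-(4 + ε)) with hh
  set q : E4 → ℝ := fun z => (Set.Iio (1:ℝ)).indicator (fun r => (r ^ 2)⁻¹) ‖z‖ with hq
  have hB : ∀ x : E4, Integrable (fun y => 6 * h y + 4 * h (x - y) + 2 * q (x - y)) := fun x =>
    ((hH.const_mul 6).add ((hH.comp_sub_left x).const_mul 4)).add
      ((hQ.comp_sub_left x).const_mul 2)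
  have hp : ∀ x y : E4, 0 ≤ jb y ^ (-(4 + ε)) * (‖x - y‖ ^ 2)⁻¹ := fun x y =>
    mul_nonneg (Real.rpow_nonneg (jb_pos' y).le _) (by positivity)
  have hI : ∀ x : E4, Integrable (fun y : E4 => jb y ^ (-(4 + ε)) * (‖x - y‖ ^ 2)⁻¹) := by
    intro x
    refine (hB x).mono' (meas_ker ε x).aestronglyMeasurable (Filter.Eventually.of_forall fun y => ?_)
    rw [Real.norm_of_nonneg (hp x y)]
    refine le_trans ?_ (ker_bound ε hε x y)
    have : 1 ≤ jb x ^ 2 := by nlinarith [one_le_jb' x]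
    nlinarith [hp x y]
  refine ⟨10 * (∫ y, h y) + 2 * ∫ y, q y, ?_, fun x => ⟨hI x, ?_⟩⟩
  · have a1 : 0 ≤ ∫ y, h y := integral_nonneg fun y => Real.rpow_nonneg (jb_pos' y).le _
    have a2 : 0 ≤ ∫ y, q y := integral_nonneg fun y =>
      Set.indicator_nonneg (fun r _ => by positivity) _
    linarith
  · rw [← integral_const_mul]
    calc _ ≤ ∫ y, (6 * h y + 4 * h (x - y) + 2 * q (x - y)) :=
          integral_mono ((hI x).const_mul _) (hB x) (fun y => ker_bound ε hε x y)
      _ = _ := by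
          have h64 : Integrable (fun y => 6 * h y + 4 * h (x - y)) :=
            (hH.const_mul 6).add ((hH.comp_sub_left x).const_mul 4)
          rw [integral_add h64
            ((hQ.comp_sub_left x).const_mul 2),
            integral_add (hH.const_mul 6) ((hH.comp_sub_left x).const_mul 4),
            integral_const_mul, integral_const_mul, integral_const_mul,
            integral_sub_left_eq_self h volume x, integral_sub_left_eq_self q volume x]
          ring

lemma diff_bound (x y : E4) (hx : 1 ≤ ‖x‖) :
    |(‖x - y‖ ^ 2)⁻¹ - (‖x‖ ^ 2)⁻¹| ≤
      jb y * ‖x‖⁻¹ * (2 * (‖x - y‖ ^ 2)⁻¹ + 2 * (‖x‖ ^ 2)⁻¹) := by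
  have hx0 : 0 < ‖x‖ := by linarith
  have hy := norm_le_jb' y
  refine le_trans ?_ (show ‖y‖ * ‖x‖⁻¹ * (2 * (‖x - y‖ ^ 2)⁻¹ + 2 * (‖x‖ ^ 2)⁻¹) ≤ _ by gcongr)
  rcases (norm_nonneg (x - y)).eq_or_lt with h0 | h0
  · have : x = y := by rw [← sub_eq_zero, ← norm_eq_zero]; exact h0.symm
    subst this
    rw [mul_inv_cancel₀ hx0.ne']
    simp
    have : 0 ≤ (‖x‖ ^ 2)⁻¹ := by positivity
    linarith
  · have t : |‖x‖ - ‖x - y‖| ≤ ‖y‖ := by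
      have := abs_norm_sub_norm_le x (x - y); simpa using this
    set a := ‖x‖
    set b := ‖x - y‖
    have e : (b ^ 2)⁻¹ - (a ^ 2)⁻¹ = (a - b) * (a⁻¹ * ((b^2)⁻¹ + a⁻¹ * b⁻¹)) := by
      field_simp; ring
    rw [e, abs_mul, abs_of_nonneg (a := a⁻¹ * _) (by positivity), mul_assoc]
    refine mul_le_mul t (mul_le_mul_of_nonneg_left ?_ (by positivity)) (by positivity)
      (norm_nonneg _)
    rw [← inv_pow, ← inv_pow]
    nlinarith [sq_nonneg (a⁻¹ - b⁻¹), sq_nonneg (a⁻¹), sq_nonneg b⁻¹]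

lemma final_arith (A K H I a j N : ℝ) (hA : 0 < A) (hK : 0 ≤ K) (hH : 0 ≤ H) (hI : 0 ≤ I)
    (ha : 1 ≤ a) (hj : 0 < j) (hsq : j ^ 2 = 1 + a ^ 2) (hIK : j ^ 2 * I ≤ K)
    (hN : N ≤ A * a⁻¹ * (2 * I + 2 * (a ^ 2)⁻¹ * H)) :
    N * j ^ 3 ≤ (2 * (2 * K + 4 * H) + 1) * A := by
  have ha0 : 0 < a := by linarith
  have h2 : j ≤ 2 * a := by
    nlinarith
  have h3 : a⁻¹ * j ≤ 2 := by
    rw [inv_mul_le_iff₀ ha0]; linarith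
  have h4 : (a ^ 2)⁻¹ * j ^ 2 ≤ 2 := by
    rw [inv_mul_le_iff₀ (by positivity)]; nlinarith
  have h5 : 2 * (j ^ 2 * I) + 2 * ((a ^ 2)⁻¹ * j ^ 2) * H ≤ 2 * K + 4 * H := by
    have := mul_le_mul_of_nonneg_right h4 hH
    linarith
  calc N * j ^ 3 ≤ A * a⁻¹ * (2 * I + 2 * (a ^ 2)⁻¹ * H) * j ^ 3 :=
        mul_le_mul_of_nonneg_right hN (by positivity)
    _ = A * ((a⁻¹ * j) * (2 * (j ^ 2 * I) + 2 * ((a ^ 2)⁻¹ * j ^ 2) * H)) := by ring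
    _ ≤ A * (2 * (2 * K + 4 * H)) := by
        refine mul_le_mul_of_nonneg_left ?_ hA.le
        exact mul_le_mul h3 h5 (by positivity) (by norm_num)
    _ ≤ _ := by linarith

set_option maxHeartbeats 1000000 in
theorem stmt_12 (ε : ℝ) (hε : 0 < ε) :
    ∃ C : ℝ, 0 < C ∧ ∀ A : ℝ, 0 < A → ∀ g : EuclideanSpace ℝ (Fin 4) → ℂ,
      Measurable g →
      (∀ y : EuclideanSpace ℝ (Fin 4), ‖g y‖ ≤ A * jb y ^ (-(5 + ε))) →
      (∫ y : EuclideanSpace ℝ (Fin 4), g y) = 0 →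
      ∀ x : EuclideanSpace ℝ (Fin 4),
        ‖∫ y : EuclideanSpace ℝ (Fin 4), g y * (((‖x - y‖ ^ 2)⁻¹ : ℝ) : ℂ)‖ ≤
          C * A * jb x ^ (-3 : ℝ) := by
  obtain ⟨K, hK, hKx⟩ := ker_integral ε hε
  have hH := jb_integrable ε hε
  set H := ∫ y : E4, jb y ^ (-(4 + ε)) with hHdef
  have hH0 : 0 ≤ H := integral_nonneg fun y => Real.rpow_nonneg (jb_pos' y).le _
  refine ⟨2 * (2 * K + 4 * H) + 1, by positivity, ?_⟩
  intro A hA g hg hgb hg0 x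
  have hsplit : ∀ y : E4, jb y ^ (-(5 + ε)) * jb y = jb y ^ (-(4 + ε)) := by
    intro y
    rw [← Real.rpow_add_one (jb_pos' y).ne']
    congr 1; ring
  have hgb' : ∀ y, ‖g y‖ ≤ A * jb y ^ (-(4 + ε)) := by
    intro y
    refine (hgb y).trans ?_
    have := Real.rpow_le_rpow_of_exponent_le (one_le_jb' y) (show -(5 + ε) ≤ -(4 + ε) by linarith)
    gcongr
  have hgi : Integrable g := (hH.const_mul A).mono' hg.aestronglyMeasurable
    (Filter.Eventually.of_forall hgb')
  obtain ⟨hI, hIK⟩ := hKx x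
  set I := ∫ y : E4, jb y ^ (-(4 + ε)) * (‖x - y‖ ^ 2)⁻¹ with hIdef
  have hb : ∀ y, ‖g y * (((‖x - y‖ ^ 2)⁻¹ : ℝ) : ℂ)‖ ≤
      A * (jb y ^ (-(4 + ε)) * (‖x - y‖ ^ 2)⁻¹) := by
    intro y
    rw [norm_mul, Complex.norm_real, Real.norm_of_nonneg (by positivity), ← mul_assoc]
    gcongr
    exact hgb' y
  have hmeas : Measurable fun y : E4 => g y * (((‖x - y‖ ^ 2)⁻¹ : ℝ) : ℂ) := by fun_prop
  have hgi2 : Integrable (fun y : E4 => g y * (((‖x - y‖ ^ 2)⁻¹ : ℝ) : ℂ)) :=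
    (hI.const_mul A).mono' hmeas.aestronglyMeasurable (Filter.Eventually.of_forall hb)
  have hj0 := jb_pos' x
  have hj : jb x ^ (-3 : ℝ) = (jb x ^ 3)⁻¹ := by
    rw [Real.rpow_neg hj0.le]; norm_cast
  have hI0 : 0 ≤ I := integral_nonneg fun y =>
    mul_nonneg (Real.rpow_nonneg (jb_pos' y).le _) (by positivity)
  have hsq := jb_sq' x
  rw [hj, ← div_eq_mul_inv, le_div_iff₀ (by positivity)]
  rcases lt_or_ge ‖x‖ 1 with hx | hx
  · have h1 : ‖∫ y : E4, g y * (((‖x - y‖ ^ 2)⁻¹ : ℝ) : ℂ)‖ ≤ A * I := by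
      rw [hIdef, ← integral_const_mul]
      exact norm_integral_le_of_norm_le (hI.const_mul A) (Filter.Eventually.of_forall hb)
    have h2 : jb x ≤ 2 := by nlinarith [norm_nonneg x]
    calc _ ≤ A * I * jb x ^ 3 := by gcongr
      _ = A * ((jb x ^ 2 * I) * jb x) := by ring
      _ ≤ A * (K * 2) := by gcongr
      _ ≤ _ := by nlinarith
  · have hx0 : 0 < ‖x‖ := by linarith
    have e : ∫ y : E4, g y * (((‖x - y‖ ^ 2)⁻¹ : ℝ) : ℂ) =
        ∫ y : E4, g y * (((‖x - y‖ ^ 2)⁻¹ - (‖x‖ ^ 2)⁻¹ : ℝ) : ℂ) := by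
      have : ∀ y : E4, g y * (((‖x - y‖ ^ 2)⁻¹ - (‖x‖ ^ 2)⁻¹ : ℝ) : ℂ) =
          g y * (((‖x - y‖ ^ 2)⁻¹ : ℝ) : ℂ) - g y * (((‖x‖ ^ 2)⁻¹ : ℝ) : ℂ) := by
        intro y; rw [Complex.ofReal_sub, mul_sub]
      simp_rw [this]
      rw [integral_sub hgi2 (hgi.mul_const _), integral_mul_const, hg0, zero_mul, sub_zero]
    have h1 : ‖∫ y : E4, g y * (((‖x - y‖ ^ 2)⁻¹ : ℝ) : ℂ)‖ ≤
        A * ‖x‖⁻¹ * (2 * I + 2 * (‖x‖ ^ 2)⁻¹ * H) := by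
      have hint := ((hI.const_mul 2).add (hH.const_mul (2 * (‖x‖ ^ 2)⁻¹))).const_mul (A * ‖x‖⁻¹)
      rw [e, hIdef, hHdef, ← integral_const_mul, ← integral_const_mul,
        ← integral_add (hI.const_mul 2) (hH.const_mul _), ← integral_const_mul]
      refine norm_integral_le_of_norm_le hint (Filter.Eventually.of_forall fun y => ?_)
      rw [norm_mul, Complex.norm_real, Real.norm_eq_abs]
      calc _ ≤ (A * jb y ^ (-(5 + ε))) *
            (jb y * ‖x‖⁻¹ * (2 * (‖x - y‖ ^ 2)⁻¹ + 2 * (‖x‖ ^ 2)⁻¹)) := by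
            have := jb_pos' y
            exact mul_le_mul (hgb y) (diff_bound x y hx) (abs_nonneg _) (by positivity)
        _ = _ := by
            rw [← hsplit y]; ring
    exact final_arith A K H I ‖x‖ (jb x) _ hA hK hH0 hI0 hx hj0 hsq hIK h1
end
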